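/- Let a, b, c, μ ∈ ℂ with Re(a-c+1) > Re μ > 0 and Re(b-c+1) > Re μ > 0, and assume that neither a+b-c+1 nor a+b-c-μ+1 is a nonpositive integer. Then for every real x > 0, ∫_{x}^{∞} y^{c-1} w₅(y;a,b,c) · (y-x)^{μ-1}/Γ(μ) dy = (Γ(b-c-μ+1)/Γ(b-c+1)) · (Γ(a-c-μ+1)/Γ(a-c+1)) · (Γ(a+b-c+1)/Γ(a+b-c-μ+1)) · x^{c+μ-1} · w₅(x;a,b,c+μ), where w₅(x;a,b,c) := F(a,b;a+b-c+1;1-x) (a fractional integral transformation of type c− for the solution w₅ of the hypergeometric differential equation). -/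

import Mathlib

open MeasureTheory Set Complex Filter

/-- Pochhammer symbol `(a)_k = a (a+1) ⋯ (a+k-1)`. -/
noncomputable def poch (a : ℂ) (k : ℕ) : ℂ := ∏ i ∈ Finset.range k, (a + i)

/-- The Gauss hypergeometric function `F(a,b;c;x)` for real `x < 1`, defined by the
power series on `[0,1)` and by the (agreeing) Pfaff series for `x < 0`. -/
noncomputable def hypF (a b c : ℂ) (x : ℝ) : ℂ :=
  if 0 ≤ x then
    ∑' k : ℕ, poch a k * poch b k / (poch c k * (Nat.factorial k : ℂ)) * (x : ℂ) ^ k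
  else
    ((1 - x : ℝ) : ℂ) ^ (-a) *
      ∑' k : ℕ, poch a k * poch (c - b) k / (poch c k * (Nat.factorial k : ℂ)) *
        (((x / (x - 1) : ℝ)) : ℂ) ^ k

/-- Kummer's solution `w₅(x;a,b,c) = F(a,b;a+b-c+1;1-x)`. -/
noncomputable def w5 (a b c : ℂ) (x : ℝ) : ℂ :=
  hypF a b (a + b - c + 1) (1 - x)

noncomputable def hc (a b c : ℂ) (k : ℕ) : ℂ :=
  poch a k * poch b k / (poch c k * (Nat.factorial k : ℂ))

lemma poch_succ (a : ℂ) (k : ℕ) : poch a (k+1) = poch a k * (a + k) := by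
  simp [poch, Finset.prod_range_succ]

lemma poch_zero (a : ℂ) : poch a 0 = 1 := by simp [poch]

lemma poch_succ' (a : ℂ) (k : ℕ) : poch a (k+1) = a * poch (a+1) k := by
  rw [poch, Finset.prod_range_succ']
  simp only [poch, Nat.cast_add, Nat.cast_one, Nat.cast_zero, add_zero]
  rw [mul_comm]
  congr 1
  apply Finset.prod_congr rfl
  intros; ring

lemma add_nat_ne {c : ℂ} (hc : ∀ n : ℕ, c ≠ -(n : ℂ)) (n : ℕ) : c + n ≠ 0 := by
  intro h
  exact hc n (eq_neg_of_add_eq_zero_left h)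

lemma poch_ne {c : ℂ} (hc : ∀ n : ℕ, c ≠ -(n : ℂ)) (k : ℕ) : poch c k ≠ 0 :=
  Finset.prod_ne_zero_iff.2 fun i _ => add_nat_ne hc i

lemma nonpole_add {c : ℂ} (hc : ∀ n : ℕ, c ≠ -(n : ℂ)) : ∀ n : ℕ, c + 1 ≠ -(n : ℂ) := by
  intro n h
  apply hc (n+1)
  push_cast
  linear_combination h

lemma hc_zero (a b c : ℂ) : hc a b c 0 = 1 := by simp [hc, poch_zero]

lemma hc_succ {a b c : ℂ} (h : ∀ n : ℕ, c ≠ -(n : ℂ)) (k : ℕ) :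
    hc a b c (k+1) * ((c + k) * (k + 1)) = hc a b c k * ((a + k) * (b + k)) := by
  have h1 := poch_ne h k
  have h2 := add_nat_ne h k
  have h3 : (Nat.factorial k : ℂ) ≠ 0 := by exact_mod_cast Nat.factorial_ne_zero k
  have h4 : (k + 1 : ℂ) ≠ 0 := by exact_mod_cast Nat.succ_ne_zero k
  simp only [hc, poch_succ, Nat.factorial_succ]
  push_cast
  field_simp

lemma hc_symm (a b c : ℂ) : hc a b c = hc b a c := by
  ext k; simp [hc, mul_comm]

lemma ratio_tendsto (a b c : ℂ) : Tendsto (fun k : ℕ => (a + k) * (b + k) / ((c + k) * (k + 1)))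
    atTop (nhds 1) := by
  have key : ∀ u v : ℂ, Tendsto (fun k : ℕ => (u + k) / (v + k)) atTop (nhds 1) := by
    intro u v
    have h0 : ∀ u : ℂ, Tendsto (fun k : ℕ => u * (k:ℂ)⁻¹ + 1) atTop (nhds 1) := by
      intro u
      have := (tendsto_inv_atTop_nhds_zero_nat (𝕜 := ℂ)).const_mul u
      simpa using this.add_const 1
    have := (h0 u).div (h0 v) one_ne_zero
    rw [div_one] at this
    refine this.congr' ?_
    filter_upwards [eventually_gt_atTop 0] with k hk
    have hk' : (k:ℂ) ≠ 0 := by exact_mod_cast hk.ne'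
    simp only [Pi.div_apply]
    rw [← mul_div_mul_right _ _ hk']
    congr 1 <;> field_simp
  have := (key a c).mul (key b 1)
  rw [one_mul] at this
  refine this.congr fun k => ?_
  rw [div_mul_div_comm, add_comm 1 (k:ℂ)]

lemma hc_summable {a b c : ℂ} (h : ∀ n : ℕ, c ≠ -(n : ℂ)) {z : ℂ} (hz : ‖z‖ < 1) :
    Summable fun k => ‖hc a b c k * z ^ k‖ := by
  obtain ⟨r, hr1, hr2⟩ := exists_between hz
  refine summable_of_ratio_norm_eventually_le (r := r) hr2 ?_
  have h1 := (ratio_tendsto a b c).norm.mul_const ‖z‖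
  rw [norm_one, one_mul] at h1
  filter_upwards [h1.eventually_lt_const hr1] with k hk
  rw [norm_norm, norm_norm]
  have h2 := add_nat_ne h k
  have h4 : (k + 1 : ℂ) ≠ 0 := by exact_mod_cast Nat.succ_ne_zero k
  have : hc a b c (k+1) * z ^ (k+1) =
      ((a + k) * (b + k) / ((c + k) * (k + 1)) * z) * (hc a b c k * z ^ k) := by
    have := hc_succ (a := a) (b := b) h k
    have h5 : hc a b c (k+1) = hc a b c k * ((a + k) * (b + k)) / ((c + k) * (k + 1)) := by
      rw [← this]; field_simp
    rw [h5, pow_succ]; field_simp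
  rw [this, norm_mul _ (hc a b c k * z ^ k), norm_mul _ z]
  exact mul_le_mul_of_nonneg_right hk.le (norm_nonneg _)

lemma one_nonpole : ∀ n : ℕ, (1:ℂ) ≠ -(n : ℂ) := by
  intro n h
  have : ((1 + n : ℕ) : ℂ) = 0 := by push_cast; rw [h]; ring
  norm_cast at this
  omega

lemma binom_coeff (a : ℂ) (n : ℕ) : Ring.choose (a + n - 1) n = hc a 1 1 n := by
  have h3 : (Nat.factorial n : ℂ) ≠ 0 := by exact_mod_cast Nat.factorial_ne_zero n
  have h := Ring.factorial_nsmul_multichoose_eq_ascPochhammer a n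
  have h2 : Ring.choose (a + n - 1) n = Ring.multichoose a n := by
    rw [Ring.choose]; congr 1; ring
  have h5 : ∀ n, (ascPochhammer ℕ n).smeval a = poch a n := by
    intro n
    induction n with
    | zero => simp [poch_zero]
    | succ n ih =>
      rw [poch_succ, ← ih, ascPochhammer_succ_right, Polynomial.smeval_mul]
      simp [Polynomial.smeval_natCast]
  rw [h5, nsmul_eq_mul] at h
  rw [h2, hc, ← h]
  have := poch_ne one_nonpole n
  field_simp

lemma binom_hasSum (a : ℂ) {z : ℂ} (hz : ‖z‖ < 1) :
    HasSum (fun n => hc a 1 1 n * z ^ n) ((1 - z) ^ (-a)) := by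
  have := (Complex.one_div_one_sub_cpow_hasFPowerSeriesOnBall_zero a).hasSum (y := z)
    (by simpa [enorm_eq_nnnorm, ← NNReal.coe_lt_coe] using hz)
  simp only [zero_add, FormalMultilinearSeries.ofScalars_apply_eq, smul_eq_mul, binom_coeff] at this
  rw [cpow_neg, ← one_div]
  exact this

noncomputable def G (a b c : ℂ) (z : ℝ) : ℂ := ∑' k : ℕ, hc a b c k * (z : ℂ) ^ k

lemma hypF_eq (a b c : ℂ) (x : ℝ) : hypF a b c x =
    if 0 ≤ x then G a b c x else ((1 - x : ℝ) : ℂ) ^ (-a) * G a (c - b) c (x / (x - 1)) := rfl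

lemma hc_contig1 {A B C : ℂ} (h : ∀ n : ℕ, C ≠ -(n : ℂ)) (k : ℕ) :
    hc A B C (k+1) = hc A B (C+1) (k+1) + A * B / (C * (C+1)) * hc (A+1) (B+1) (C+2) k := by
  have h0 : C ≠ 0 := by simpa using h 0
  have h01 : C + 1 ≠ 0 := by simpa using add_nat_ne h 1
  have h1 := poch_ne (nonpole_add h) k
  have h2 := add_nat_ne (nonpole_add h) k
  have h3 : (Nat.factorial k : ℂ) ≠ 0 := by exact_mod_cast Nat.factorial_ne_zero k
  have h4 : (k + 1 : ℂ) ≠ 0 := by exact_mod_cast Nat.succ_ne_zero k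
  have h5 : poch (C+2) k = poch (C+1) k * (C + 1 + k) / (C+1) := by
    rw [← poch_succ, poch_succ', show C + 1 + 1 = C + 2 by ring]; field_simp
  simp only [hc]
  rw [h5, poch_succ (C+1), poch_succ' A, poch_succ' B, poch_succ' C, Nat.factorial_succ]
  push_cast
  field_simp
  ring

lemma hc_contig2 {A D C : ℂ} (h : ∀ n : ℕ, C ≠ -(n : ℂ)) (k : ℕ) :
    hc A D C (k+1) = hc A (D+1) (C+1) (k+1) +
      (-(A * (C - D) / (C * (C+1)))) * hc (A+1) (D+1) (C+2) k := by
  have h0 : C ≠ 0 := by simpa using h 0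
  have h01 : C + 1 ≠ 0 := by simpa using add_nat_ne h 1
  have h1 := poch_ne (nonpole_add h) k
  have h2 := add_nat_ne (nonpole_add h) k
  have h3 : (Nat.factorial k : ℂ) ≠ 0 := by exact_mod_cast Nat.factorial_ne_zero k
  have h4 : (k + 1 : ℂ) ≠ 0 := by exact_mod_cast Nat.succ_ne_zero k
  have h5 : poch (C+2) k = poch (C+1) k * (C + 1 + k) / (C+1) := by
    rw [← poch_succ, poch_succ', show C + 1 + 1 = C + 2 by ring]; field_simp
  simp only [hc]
  rw [h5, poch_succ (C+1), poch_succ (D+1), poch_succ' A, poch_succ' D, poch_succ' C,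
    Nat.factorial_succ]
  push_cast
  field_simp
  ring

lemma tsum_shift {f g h : ℕ → ℂ} {m z : ℂ} (hf : Summable fun k => ‖f k * z ^ k‖)
    (hg : Summable fun k => ‖g k * z ^ k‖) (hh : Summable fun k => ‖h k * z ^ k‖)
    (h0 : f 0 = g 0) (h1 : ∀ k, f (k+1) = g (k+1) + m * h k) :
    ∑' k, f k * z ^ k = ∑' k, g k * z ^ k + m * z * ∑' k, h k * z ^ k := by
  have hf' := hf.of_norm
  have hg' := hg.of_norm
  have hh' := hh.of_norm
  rw [hf'.tsum_eq_zero_add, hg'.tsum_eq_zero_add, h0, add_assoc, ← tsum_mul_left]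
  congr 1
  rw [← Summable.tsum_add ((summable_nat_add_iff 1).2 hg') (hh'.mul_left _)]
  congr 1; ext k
  rw [h1, pow_succ]; ring

lemma pfaff_lt {z : ℝ} (hz : z < 0) : 0 ≤ z / (z-1) ∧ z / (z-1) < 1 := by
  constructor
  · exact div_nonneg_of_nonpos hz.le (by linarith)
  · rw [div_lt_one_of_neg (by linarith)]; linarith

lemma norm_lt {z : ℝ} (h0 : 0 ≤ z) (h1 : z < 1) : ‖(z:ℂ)‖ < 1 := by
  simpa [abs_of_nonneg h0] using h1

lemma hypF_contig {A B C : ℂ} (h : ∀ n : ℕ, C ≠ -(n : ℂ)) {z : ℝ} (hz : z < 1) :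
    hypF A B C z = hypF A B (C+1) z + A * B / (C * (C+1)) * z * hypF (A+1) (B+1) (C+2) z := by
  have hC1 := nonpole_add h
  have hC2 : ∀ n : ℕ, C + 2 ≠ -(n : ℂ) := by
    have := nonpole_add hC1
    rwa [show C + 1 + 1 = C + 2 by ring] at this
  rw [hypF_eq, hypF_eq, hypF_eq]
  split_ifs with h0
  · exact tsum_shift (hc_summable h (norm_lt h0 hz)) (hc_summable hC1 (norm_lt h0 hz))
      (hc_summable hC2 (norm_lt h0 hz)) (by simp [hc_zero]) (hc_contig1 h)
  · push Not at h0
    obtain ⟨p0, p1⟩ := pfaff_lt h0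
    have := tsum_shift (hc_summable (a := A) (b := C - B) h (norm_lt p0 p1))
      (hc_summable (a := A) (b := C - B + 1) hC1 (norm_lt p0 p1))
      (hc_summable (a := A + 1) (b := C - B + 1) hC2 (norm_lt p0 p1)) (by simp [hc_zero]) (hc_contig2 h)
    change G _ _ _ _ = G _ _ _ _ + _ * G _ _ _ _ at this
    rw [this, show C + 1 - B = C - B + 1 by ring, show C + 2 - (B + 1) = C - B + 1 by ring]
    have hz1 : (1 - z : ℂ) ≠ 0 := by
      have : (1 - z) ≠ 0 := by linarith
      exact_mod_cast this
    have hz2 : (z - 1 : ℂ) ≠ 0 := by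
      rw [← neg_sub]; exact neg_ne_zero.2 hz1
    have e : ((1 - z : ℝ) : ℂ) ^ (-(A+1)) = ((1 - z : ℝ) : ℂ) ^ (-A) * (1 - z : ℂ)⁻¹ := by
      push_cast
      rw [neg_add, cpow_add _ _ hz1, cpow_neg_one]
    have hC0 : C ≠ 0 := by simpa using h 0
    have h01 : C + 1 ≠ 0 := by simpa using add_nat_ne h 1
    rw [e, mul_add]
    congr 1
    push_cast
    have : (z:ℂ) / (z - 1) = - (z * (1 - z : ℂ)⁻¹) := by
      field_simp; ring
    rw [this]
    ring

open PowerSeries in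
lemma coeff_ode (a b c : ℂ) (F : ℂ⟦X⟧) (n : ℕ) :
    coeff n (X * (1 - X) * d⁄dX ℂ (d⁄dX ℂ F) + (C c - C (a+b+1) * X) * d⁄dX ℂ F - C (a * b) * F)
     = (n+1) * (c + n) * coeff (n+1) F - (a+n) * (b+n) * coeff n F := by
  have e : X * (1 - X) * d⁄dX ℂ (d⁄dX ℂ F) + (C c - C (a+b+1) * X) * d⁄dX ℂ F - C (a * b) * F
    = X * d⁄dX ℂ (d⁄dX ℂ F) - X * (X * d⁄dX ℂ (d⁄dX ℂ F)) + C c * d⁄dX ℂ F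
      - C (a+b+1) * (X * d⁄dX ℂ F) - C (a*b) * F := by ring
  rw [e]
  obtain ⟨s, hs⟩ : ∃ s, s = a + b + 1 := ⟨_, rfl⟩
  obtain ⟨p, hp⟩ : ∃ p, p = a * b := ⟨_, rfl⟩
  rw [← hs, ← hp]
  simp only [map_sub, map_add, coeff_C_mul]
  have e2 : (a + n) * (b + n) = p + (s - 1) * n + n ^ 2 := by rw [hs, hp]; ring
  rw [e2]
  clear hs hp e e2
  rcases n with _ | _ | n
  · simp [coeff_derivative]
  · simp [coeff_succ_X_mul, coeff_derivative]; ring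
  · simp [coeff_succ_X_mul, coeff_derivative]; ring

open PowerSeries in
lemma euler_formal {a b c : ℂ} (h : ∀ n : ℕ, c ≠ -(n : ℂ)) :
    PowerSeries.mk (hc (a+b-c) 1 1) * PowerSeries.mk (hc (c-a) (c-b) c)
      = PowerSeries.mk (hc a b c) := by
  set P : ℂ⟦X⟧ := PowerSeries.mk (hc (a+b-c) 1 1) with hP
  set H : ℂ⟦X⟧ := PowerSeries.mk (hc (c-a) (c-b) c) with hH
  have hPd : (1 - X) * d⁄dX ℂ P = C (a+b-c) * P := by
    ext n
    rw [sub_mul, one_mul, map_sub, coeff_C_mul]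
    have key : ∀ n : ℕ, coeff (n+1) P * (n+1) = (a+b-c + n) * coeff n P := by
      intro n
      have := hc_succ (a := a+b-c) (b := 1) one_nonpole n
      have h4 : (1 + n : ℂ) ≠ 0 := add_nat_ne one_nonpole n
      rw [hP, coeff_mk, coeff_mk]
      apply mul_right_cancel₀ h4
      linear_combination this
    rcases n with _ | n
    · simpa [coeff_derivative] using key 0
    · rw [coeff_succ_X_mul, coeff_derivative, coeff_derivative, key]
      push_cast
      ring
  have hPd2 : (1 - X) * ((1 - X) * d⁄dX ℂ (d⁄dX ℂ P)) = C (a+b-c) * C (a+b-c+1) * P := by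
    have := congrArg (d⁄dX ℂ) hPd
    simp only [Derivation.leibniz, smul_eq_mul, map_sub, derivative_X] at this
    simp at this
    have e1 : C (a+b-c+1) = C (a+b-c) + (1 : ℂ⟦X⟧) := by rw [map_add, map_one]
    rw [e1]
    simp only [map_sub, map_add] at *
    linear_combination (1 - X) * this + (C a + C b - C c + 1) * hPd
  have hHode : X * (1 - X) * d⁄dX ℂ (d⁄dX ℂ H)
      + (C c - C ((c-a)+(c-b)+1) * X) * d⁄dX ℂ H - C ((c-a) * (c-b)) * H = 0 := by
    ext n
    rw [coeff_ode, hH, coeff_mk, coeff_mk, map_zero]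
    linear_combination hc_succ (a := c-a) (b := c-b) h n
  have hprod : X * (1 - X) * d⁄dX ℂ (d⁄dX ℂ (P*H)) + (C c - C (a+b+1) * X) * d⁄dX ℂ (P*H)
      - C (a * b) * (P*H) = 0 := by
    have hne : (1 - X : ℂ⟦X⟧) ≠ 0 := by
      intro h
      have := congrArg (coeff 0) h
      simp at this
    apply mul_left_cancel₀ hne
    rw [mul_zero]
    simp only [Derivation.leibniz, smul_eq_mul, map_add, map_sub, map_mul, map_one] at *
    linear_combination (1 - X) * P * hHode + X * H * hPd2
      + (2 * X * (1 - X) * d⁄dX ℂ H + (C c - (C a + C b + 1) * X) * H) * hPd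
  ext n
  rw [coeff_mk]
  induction n with
  | zero => simp [hP, hH, hc_zero]
  | succ n ih =>
    have e := congrArg (coeff n) hprod
    rw [coeff_ode, map_zero, ih] at e
    have h2 := add_nat_ne h n
    have h4 : (n + 1 : ℂ) ≠ 0 := by exact_mod_cast Nat.succ_ne_zero n
    apply mul_left_cancel₀ (mul_ne_zero h4 h2)
    linear_combination e - hc_succ (a := a) (b := b) h n

lemma G_euler {a b c : ℂ} (h : ∀ n : ℕ, c ≠ -(n : ℂ)) {z : ℝ} (h0 : 0 ≤ z) (h1 : z < 1) :
    (1 - z : ℂ) ^ (c - a - b) * G (c-a) (c-b) c z = G a b c z := by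
  have hn := norm_lt h0 h1
  have e := (binom_hasSum (a+b-c) hn).tsum_eq
  rw [show c - a - b = -(a+b-c) by ring, ← e, G, G,
    tsum_mul_tsum_eq_tsum_sum_antidiagonal_of_summable_norm (hc_summable one_nonpole hn)
      (hc_summable h hn)]
  congr 1; ext n
  have := congrArg (PowerSeries.coeff n) (euler_formal (a := a) (b := b) h)
  rw [PowerSeries.coeff_mul, PowerSeries.coeff_mk] at this
  rw [← this, Finset.sum_mul]
  apply Finset.sum_congr rfl
  rintro ⟨i, j⟩ hij
  rw [← Finset.HasAntidiagonal.mem_antidiagonal.1 hij]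
  simp only [PowerSeries.coeff_mk, pow_add]
  ring

/-- Euler transformation for `w5`. -/
lemma w5_euler {a b c : ℂ} (h : ∀ n : ℕ, a + b - c + 1 ≠ -(n : ℂ)) {y : ℝ} (hy : 0 < y) :
    (y:ℂ) ^ (c - 1) * w5 a b c y = hypF (a-c+1) (b-c+1) (a+b-c+1) (1 - y) := by
  have hyne : (y:ℂ) ≠ 0 := by exact_mod_cast hy.ne'
  rw [w5, hypF_eq, hypF_eq]
  split_ifs with h0
  · rw [← G_euler h h0 (by linarith), ← mul_assoc]
    have : (1 - ((1 - y : ℝ):ℂ)) = y := by push_cast; ring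
    rw [this, ← cpow_add _ _ hyne]
    rw [show c - 1 + (a + b - c + 1 - a - b) = 0 by ring, cpow_zero, one_mul]
    rw [show a + b - c + 1 - a = b - c + 1 by ring, show a + b - c + 1 - b = a - c + 1 by ring]
    simp only [G]
    rw [hc_symm]
  · rw [← mul_assoc]
    have : ((1 - (1 - y) : ℝ):ℂ) = y := by push_cast; ring
    rw [this, ← cpow_add _ _ hyne]
    rw [show a + b - c + 1 - b = a - c + 1 by ring, show a + b - c + 1 - (b - c + 1) = a by ring]
    simp only [G]
    rw [hc_symm]
    congr 2
    ring

lemma re_pos_nonpole {c : ℂ} (h : 0 < c.re) : ∀ n : ℕ, c ≠ -(n : ℂ) := by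
  intro n hn
  rw [hn] at h
  simp at h
  exact absurd h (by have := Nat.cast_nonneg (α := ℝ) n; linarith)

lemma gamma_poch {s : ℂ} (hs : ∀ n : ℕ, s ≠ -(n : ℂ)) (k : ℕ) :
    Gamma (s + k) = poch s k * Gamma s := by
  induction k with
  | zero => simp [poch_zero]
  | succ k ih =>
    push_cast
    rw [← add_assoc, Gamma_add_one _ (add_nat_ne hs k), ih, poch_succ]; ring

lemma beta_poch {B D : ℂ} (hB : 0 < B.re) (hD : 0 < D.re) (k : ℕ) :
    betaIntegral (B + k) D = betaIntegral B D * (poch B k / poch (B + D) k) := by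
  have hk : 0 < (B + k).re := by
    have := Nat.cast_nonneg (α := ℝ) k
    simp; linarith
  have hBD : 0 < (B + D).re := by simp; linarith
  rw [betaIntegral_eq_Gamma_mul_div _ _ hk hD, betaIntegral_eq_Gamma_mul_div _ _ hB hD,
    show B + k + D = B + D + k by ring, gamma_poch (re_pos_nonpole hB),
    gamma_poch (re_pos_nonpole hBD)]
  have := Gamma_ne_zero_of_re_pos hBD
  have := poch_ne (re_pos_nonpole hBD) k
  field_simp

lemma beta_Ioo (B D : ℂ) : betaIntegral B D =
    ∫ t in Ioo (0:ℝ) 1, (t:ℂ) ^ (B - 1) * (1 - (t:ℂ)) ^ (D - 1) := by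
  rw [betaIntegral, intervalIntegral.integral_of_le zero_le_one, integral_Ioc_eq_integral_Ioo]

lemma beta_int {B D : ℂ} (hB : 0 < B.re) (hD : 0 < D.re) :
    IntegrableOn (fun t : ℝ => (t:ℂ) ^ (B - 1) * (1 - (t:ℂ)) ^ (D - 1)) (Ioo 0 1) := by
  have := betaIntegral_convergent hB hD
  rw [intervalIntegrable_iff_integrableOn_Ioo_of_le zero_le_one] at this
  exact this

lemma series_int {A B D : ℂ} (hB : 0 < B.re) (hD : 0 < D.re) {z : ℝ} (h0 : 0 ≤ z) (h1 : z < 1) :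
    ∫ t in Ioo (0:ℝ) 1, (t:ℂ) ^ (B - 1) * (1 - (t:ℂ)) ^ (D - 1) * ((1 - t * z : ℝ) : ℂ) ^ (-A)
      = betaIntegral B D * G A B (B + D) z := by
  have hn := norm_lt h0 h1
  let F : ℕ → ℝ → ℂ := fun k t =>
    hc A 1 1 k * (z:ℂ) ^ k * ((t:ℂ) ^ (B + k - 1) * (1 - (t:ℂ)) ^ (D - 1))
  have hBk : ∀ k : ℕ, 0 < (B + k).re := fun k => by
    have := Nat.cast_nonneg (α := ℝ) k
    simp; linarith
  have hF1 : ∀ k, Integrable (F k) (volume.restrict (Ioo 0 1)) := fun k =>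
    (beta_int (hBk k) hD).const_mul _
  have hpow : ∀ t ∈ Ioo (0:ℝ) 1, ∀ k : ℕ, (t:ℂ) ^ (B + k - 1) = t ^ (B - 1) * t ^ k := by
    intro t ht k
    have : (t:ℂ) ≠ 0 := by exact_mod_cast ht.1.ne'
    rw [show B + k - 1 = B - 1 + k by ring, cpow_add _ _ this, cpow_natCast]
  have hF2 : Summable fun k => ∫ t in Ioo (0:ℝ) 1, ‖F k t‖ := by
    refine Summable.of_nonneg_of_le (fun k => integral_nonneg fun _ => norm_nonneg _) (fun k => ?_)
      ((hc_summable (a := A) (b := 1) one_nonpole hn).mul_right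
        (∫ t in Ioo (0:ℝ) 1, ‖(t:ℂ) ^ (B - 1) * (1 - (t:ℂ)) ^ (D - 1)‖))
    rw [← integral_const_mul]
    refine setIntegral_mono_on (hF1 k).norm ((beta_int hB hD).norm.const_mul _)
      measurableSet_Ioo ?_
    intro t ht
    simp only [F]
    rw [hpow t ht, norm_mul (hc A 1 1 k * (z:ℂ)^k)]
    gcongr
    rw [norm_mul, norm_mul _ ((1 - (t:ℂ)) ^ (D - 1)), norm_mul]
    gcongr
    have : ‖(t:ℂ) ^ k‖ ≤ 1 := by
      rw [norm_pow]
      apply pow_le_one₀ (norm_nonneg _)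
      simpa [abs_of_pos ht.1] using ht.2.le
    exact mul_le_of_le_one_right (norm_nonneg _) this
  have hs := hasSum_integral_of_summable_integral_norm hF1 hF2
  have e1 : ∫ t in Ioo (0:ℝ) 1, ∑' k, F k t = ∫ t in Ioo (0:ℝ) 1,
      (t:ℂ) ^ (B - 1) * (1 - (t:ℂ)) ^ (D - 1) * ((1 - t * z : ℝ) : ℂ) ^ (-A) := by
    refine setIntegral_congr_fun measurableSet_Ioo ?_
    intro t ht
    have hz : ‖((t * z : ℝ):ℂ)‖ < 1 := by
      apply norm_lt (mul_nonneg ht.1.le h0)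
      nlinarith [ht.1, ht.2]
    have := (binom_hasSum A hz).mul_left ((t:ℂ) ^ (B - 1) * (1 - (t:ℂ)) ^ (D - 1))
    simp only
    rw [show ((1 - t * z : ℝ):ℂ) = 1 - ((t * z : ℝ):ℂ) by push_cast; ring, ← this.tsum_eq]
    congr 1; ext k
    simp only [F]
    rw [hpow t ht]
    push_cast
    ring
  rw [← e1, ← hs.tsum_eq, G, ← tsum_mul_left]
  congr 1; ext k
  simp only [F]
  rw [integral_const_mul, ← beta_Ioo, beta_poch hB hD]
  simp only [hc]
  have hBD : 0 < (B + D).re := by simp; linarith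
  have := poch_ne (re_pos_nonpole hBD) k
  have := poch_ne one_nonpole k
  have h3 : (Nat.factorial k : ℂ) ≠ 0 := by exact_mod_cast Nat.factorial_ne_zero k
  field_simp

lemma euler_int {A B D : ℂ} (hB : 0 < B.re) (hD : 0 < D.re) {y : ℝ} (hy : 0 < y) :
    ∫ t in Ioo (0:ℝ) 1, (t:ℂ) ^ (B - 1) * (1 - (t:ℂ)) ^ (D - 1) * ((1 - t + t * y : ℝ) : ℂ) ^ (-A)
      = betaIntegral B D * hypF A B (B + D) (1 - y) := by
  rw [hypF_eq]
  split_ifs with h0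
  · rw [← series_int hB hD h0 (by linarith)]
    congr 1; ext t
    congr 3; ring
  · push Not at h0
    obtain ⟨p0, p1⟩ := pfaff_lt h0
    rw [show B + D - B = D by ring, mul_left_comm, add_comm B D, betaIntegral_symm,
      ← series_int hD hB p0 p1, ← integral_const_mul]
    rw [← integral_Ioc_eq_integral_Ioo, ← integral_Ioc_eq_integral_Ioo,
      ← intervalIntegral.integral_of_le zero_le_one, ← intervalIntegral.integral_of_le zero_le_one]
    have := intervalIntegral.integral_comp_sub_left (a := 0) (b := 1) (fun t : ℝ =>
      (t:ℂ) ^ (B - 1) * (1 - (t:ℂ)) ^ (D - 1) * ((1 - t + t * y : ℝ) : ℂ) ^ (-A)) 1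
    rw [sub_self, sub_zero] at this
    rw [← this]
    refine intervalIntegral.integral_congr fun t ht => ?_
    rw [uIcc_of_le zero_le_one] at ht
    have hy1 : 1 < y := by linarith
    have e1 : (1 - (1 - t) + (1 - t) * y) = y * (1 - t * ((1 - y) / (1 - y - 1))) := by
      rw [show 1 - y - 1 = -y by ring]
      field_simp; ring
    have hq : 0 ≤ (1 - t * ((1 - y) / (1 - y - 1))) := by
      nlinarith [ht.1, ht.2]
    rw [e1, ofReal_mul, mul_cpow_ofReal_nonneg hy.le hq, show (1 - (1 - y)) = y by ring]
    push_cast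
    rw [show (1:ℂ) - (1 - t) = t by ring]
    ring

lemma kern_image {x r : ℝ} (hr : 0 < r) :
    (fun s : ℝ => x + r * (s / (1 - s))) '' Ioo 0 1 = Ioi x := by
  ext y
  simp only [mem_image, mem_Ioo, mem_Ioi]
  constructor
  · rintro ⟨s, ⟨h0, h1⟩, rfl⟩
    have : 0 < s / (1 - s) := div_pos h0 (by linarith)
    nlinarith [mul_pos hr this]
  · intro h
    have h1 : 0 < r + (y - x) := by linarith
    refine ⟨(y - x) / (r + (y - x)), ⟨div_pos (by linarith) h1, ?_⟩, ?_⟩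
    · rw [div_lt_one h1]; linarith
    · have : 1 - (y - x) / (r + (y - x)) = r / (r + (y - x)) := by field_simp; ring
      rw [this]; field_simp; ring

lemma kern_inj {x r : ℝ} (hr : 0 < r) :
    InjOn (fun s : ℝ => x + r * (s / (1 - s))) (Ioo 0 1) := by
  intro s hs u hu h
  simp only at h
  have h1 : s / (1 - s) = u / (1 - u) := by
    have := mul_left_cancel₀ hr.ne' (add_left_cancel h)
    exact this
  have hs1 : 1 - s ≠ 0 := by linarith [hs.2]
  have hu1 : 1 - u ≠ 0 := by linarith [hu.2]
  rw [div_eq_div_iff hs1 hu1] at h1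
  linarith

lemma kern_deriv {x r : ℝ} : ∀ s ∈ Ioo (0:ℝ) 1,
    HasDerivWithinAt (fun s : ℝ => x + r * (s / (1 - s))) (r * (1 / (1 - s) ^ 2)) (Ioo 0 1) s := by
  intro s hs
  have hs1 : 1 - s ≠ 0 := by linarith [hs.2]
  apply HasDerivAt.hasDerivWithinAt
  have := (((hasDerivAt_id s).div ((hasDerivAt_id s).const_sub 1) hs1).const_mul r).const_add x
  refine HasDerivAt.congr_deriv this ?_
  change r * ((1 * (1 - s) - s * -1) / (1 - s) ^ 2) = _
  ring

lemma kern_pt (A μ : ℂ) {x p t : ℝ} (hp : 0 < p) (ht : 0 < t) {s : ℝ} (hs : s ∈ Ioo (0:ℝ) 1) :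
    |p / t * (1 / (1 - s) ^ 2)| •
      (((p + t * (x + p / t * (s / (1 - s)) - x) : ℝ) : ℂ) ^ (-A) *
        ((x + p / t * (s / (1 - s)) - x : ℝ) : ℂ) ^ (μ - 1))
    = ((t:ℂ) ^ (-μ) * (p:ℂ) ^ (μ - A)) *
        ((s:ℂ) ^ (μ - 1) * (1 - (s:ℂ)) ^ ((A - μ) - 1)) := by
  have hs1 : 0 < 1 - s := by linarith [hs.2]
  have hs0 := hs.1
  have e1 : p + t * (x + p / t * (s / (1 - s)) - x) = p * (1 - s)⁻¹ := by field_simp; ring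
  have e2 : x + p / t * (s / (1 - s)) - x = p * t⁻¹ * s * (1 - s)⁻¹ := by field_simp; ring
  rw [e1, e2, abs_of_pos (by positivity)]
  have hexp : ∀ (r : ℝ) (_ : 0 < r) (w : ℂ), (r:ℂ) ^ w = exp (Real.log r * w) := by
    intro r hr w
    rw [cpow_def_of_ne_zero (by exact_mod_cast hr.ne'), ofReal_log hr.le]
  have hlin : ((p / t * (1 / (1 - s) ^ 2) : ℝ) : ℂ)
      = exp (Real.log p - Real.log t - 2 * Real.log (1 - s)) := by
    rw [← ofReal_sub, show (2:ℂ) * (Real.log (1 - s) : ℂ) = ((2 * Real.log (1-s) : ℝ):ℂ) by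
      push_cast; ring, ← ofReal_sub, ← ofReal_exp, Real.exp_sub, Real.exp_sub, Real.exp_log hp,
      Real.exp_log ht, two_mul, Real.exp_add, Real.exp_log hs1]
    congr 1; field_simp
  rw [real_smul, hlin, hexp _ (by positivity), hexp _ (by positivity), hexp _ ht, hexp _ hp,
    hexp _ hs0, show (1 - (s:ℂ)) = ((1 - s : ℝ):ℂ) by push_cast; ring, hexp _ hs1]
  rw [Real.log_mul (by positivity) (by positivity), Real.log_mul (by positivity) (by positivity),
    Real.log_mul (by positivity) (by positivity), Real.log_mul (by positivity) (by positivity),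
    Real.log_inv, Real.log_inv]
  simp only [← Complex.exp_add]
  congr 1
  push_cast
  ring

lemma kern_int {A μ : ℂ} (hμ : 0 < μ.re) (hA : μ.re < A.re) {x p t : ℝ} (hp : 0 < p) (ht : 0 < t) :
    IntegrableOn (fun y : ℝ => ((p + t * (y - x) : ℝ) : ℂ) ^ (-A) * ((y - x : ℝ) : ℂ) ^ (μ - 1))
      (Ioi x) := by
  have hr := div_pos hp ht
  rw [← kern_image hr, integrableOn_image_iff_integrableOn_abs_deriv_smul measurableSet_Ioo
    kern_deriv (kern_inj hr)]
  have : 0 < (A - μ).re := by simp; linarith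
  refine IntegrableOn.congr_fun
    ((beta_int hμ this).const_mul ((t:ℂ) ^ (-μ) * (p:ℂ) ^ (μ - A))) ?_ measurableSet_Ioo
  intro s hs
  exact (kern_pt A μ hp ht hs).symm

lemma kern_val (A μ : ℂ) {x p t : ℝ} (hp : 0 < p) (ht : 0 < t) :
    ∫ y in Ioi x, ((p + t * (y - x) : ℝ) : ℂ) ^ (-A) * ((y - x : ℝ) : ℂ) ^ (μ - 1)
      = ((t:ℂ) ^ (-μ) * (p:ℂ) ^ (μ - A)) * betaIntegral μ (A - μ) := by
  have hr := div_pos hp ht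
  rw [← kern_image hr, integral_image_eq_integral_abs_deriv_smul measurableSet_Ioo
    kern_deriv (kern_inj hr), beta_Ioo, ← integral_const_mul]
  refine setIntegral_congr_fun measurableSet_Ioo fun s hs => ?_
  exact kern_pt A μ hp ht hs

lemma kern_norm (A μ : ℂ) {x p t : ℝ} (hp : 0 < p) (ht : 0 < t) :
    ∫ y in Ioi x, ‖((p + t * (y - x) : ℝ) : ℂ) ^ (-A) * ((y - x : ℝ) : ℂ) ^ (μ - 1)‖
      = ‖(t:ℂ) ^ (-μ) * (p:ℂ) ^ (μ - A)‖ *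
        ∫ s in Ioo (0:ℝ) 1, ‖(s:ℂ) ^ (μ - 1) * (1 - (s:ℂ)) ^ ((A - μ) - 1)‖ := by
  have hr := div_pos hp ht
  rw [← kern_image hr, integral_image_eq_integral_abs_deriv_smul measurableSet_Ioo
    kern_deriv (kern_inj hr), ← integral_const_mul]
  refine setIntegral_congr_fun measurableSet_Ioo fun s hs => ?_
  rw [← norm_mul, ← kern_pt A μ (x := x) hp ht hs, norm_smul, norm_mul, smul_eq_mul, Real.norm_eq_abs, abs_abs]

lemma weyl_base {A B D μ : ℂ} (hμ : 0 < μ.re) (hA : μ.re < A.re) (hB : μ.re < B.re)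
    (hD : 0 < D.re) {x : ℝ} (hx : 0 < x) :
    IntegrableOn (fun y : ℝ => hypF A B (B + D) (1 - y) * ((y - x : ℝ) : ℂ) ^ (μ - 1)) (Ioi x) ∧
    betaIntegral B D * ∫ y in Ioi x, hypF A B (B + D) (1 - y) * ((y - x : ℝ) : ℂ) ^ (μ - 1)
      = betaIntegral μ (A - μ) * (betaIntegral (B - μ) D *
          hypF (A - μ) (B - μ) (B - μ + D) (1 - x)) := by
  have hB0 : 0 < B.re := by linarith
  have hBμ : 0 < (B - μ).re := by simp; linarith
  have hβ : betaIntegral B D ≠ 0 := by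
    have h := Gamma_mul_Gamma_eq_betaIntegral hB0 hD
    intro h0
    rw [h0, mul_zero] at h
    exact mul_ne_zero (Gamma_ne_zero_of_re_pos hB0) (Gamma_ne_zero_of_re_pos hD) h
  let f : ℝ × ℝ → ℂ := fun q => (q.2:ℂ) ^ (B - 1) * (1 - (q.2:ℂ)) ^ (D - 1) *
    (((1 - q.2 + q.2 * x + q.2 * (q.1 - x) : ℝ) : ℂ) ^ (-A) * ((q.1 - x : ℝ) : ℂ) ^ (μ - 1))
  have hfm : Measurable f := by
    simp only [f]
    fun_prop
  have hp : ∀ t ∈ Ioo (0:ℝ) 1, 0 < 1 - t + t * x := fun t ht => by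
    have := mul_pos ht.1 hx
    linarith [ht.2]
  have hpow : ∀ t ∈ Ioo (0:ℝ) 1, (t:ℂ) ^ (B - 1) * (t:ℂ) ^ (-μ) = t ^ (B - μ - 1) := by
    intro t ht
    have : (t:ℂ) ≠ 0 := by exact_mod_cast ht.1.ne'
    rw [← cpow_add _ _ this]
    congr 1; ring
  have hfint : Integrable f ((volume.restrict (Ioi x)).prod (volume.restrict (Ioo (0:ℝ) 1))) := by
    rw [integrable_prod_iff' hfm.aestronglyMeasurable]
    constructor
    · refine (ae_restrict_iff' measurableSet_Ioo).2 (ae_of_all _ fun t ht => ?_)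
      exact Integrable.const_mul (kern_int (x := x) hμ hA (hp t ht) ht.1)
        ((t:ℂ) ^ (B - 1) * (1 - (t:ℂ)) ^ (D - 1))
    · set M := ∫ s in Ioo (0:ℝ) 1, ‖(s:ℂ) ^ (μ - 1) * (1 - (s:ℂ)) ^ ((A - μ) - 1)‖ with hM
      have h1 : Integrable (fun t : ℝ => ((t:ℂ) ^ (B - μ - 1) * (1 - (t:ℂ)) ^ (D - 1)) *
          ((1 - t + t * x : ℝ) : ℂ) ^ (μ - A)) (volume.restrict (Ioo (0:ℝ) 1)) := by
        have hcont : ContinuousOn (fun t : ℝ => ((1 - t + t * x : ℝ) : ℂ) ^ (μ - A)) (Icc 0 1) := by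
          apply ContinuousOn.cpow_const
          · fun_prop
          · intro t ht
            refine ofReal_mem_slitPlane.2 ?_
            nlinarith [ht.1, ht.2, mul_nonneg ht.1 hx.le]
        obtain ⟨K, hK⟩ := isCompact_Icc.exists_bound_of_continuousOn hcont
        refine Integrable.mul_bdd (c := K) (beta_int hBμ hD) ?_ ?_
        · exact Measurable.aestronglyMeasurable (by fun_prop)
        · exact (ae_restrict_iff' measurableSet_Ioo).2
            (ae_of_all _ fun t ht => hK t ⟨ht.1.le, ht.2.le⟩)
      refine (h1.norm.mul_const M).congr ?_
      refine (ae_restrict_iff' measurableSet_Ioo).2 (ae_of_all _ fun t ht => ?_)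
      simp only [f]
      simp_rw [norm_mul ((t:ℂ) ^ (B - 1) * (1 - (t:ℂ)) ^ (D - 1))]
      rw [integral_const_mul, kern_norm A μ (hp t ht) ht.1, ← hM, ← mul_assoc, ← norm_mul,
        ← hpow t ht]
      congr 2
      ring
  have hy : ∀ y ∈ Ioi x, ∫ t in Ioo (0:ℝ) 1, f (y, t) =
      betaIntegral B D * (hypF A B (B + D) (1 - y) * ((y - x : ℝ) : ℂ) ^ (μ - 1)) := by
    intro y hy
    have hy0 : 0 < y := hx.trans hy
    rw [← mul_assoc, ← euler_int hB0 hD hy0, ← integral_mul_const]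
    congr 1; ext t
    simp only [f]
    rw [show 1 - t + t * x + t * (y - x) = 1 - t + t * y by ring, mul_assoc]
    ring
  constructor
  · have h2 := hfint.integral_prod_left.const_mul (betaIntegral B D)⁻¹
    refine IntegrableOn.congr_fun h2 ?_ measurableSet_Ioi
    intro y hyx
    simp only
    rw [hy y hyx, inv_mul_cancel_left₀ hβ]
  · rw [← integral_const_mul]
    have h3 : ∫ y in Ioi x, betaIntegral B D *
        (hypF A B (B + D) (1 - y) * ((y - x : ℝ) : ℂ) ^ (μ - 1))
        = ∫ y in Ioi x, ∫ t in Ioo (0:ℝ) 1, f (y, t) :=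
      setIntegral_congr_fun measurableSet_Ioi fun y h => (hy y h).symm
    rw [h3, integral_integral_swap (f := fun y t => f (y, t)) hfint, ← euler_int hBμ hD hx,
      ← integral_const_mul]
    refine setIntegral_congr_fun measurableSet_Ioo fun t ht => ?_
    simp only [f]
    rw [integral_const_mul, kern_val A μ (hp t ht) ht.1, ← hpow t ht, neg_sub]
    ring

/-- the Gamma factor -/
noncomputable def KK (A B C μ : ℂ) : ℂ :=
  Gamma (A - μ) * Gamma (B - μ) * Gamma C / (Gamma A * Gamma B * Gamma (C - μ))

lemma weyl_base' {A B C μ : ℂ} (hμ : 0 < μ.re) (hA : μ.re < A.re) (hB : μ.re < B.re)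
    (hC : B.re < C.re) {x : ℝ} (hx : 0 < x) :
    IntegrableOn (fun y : ℝ => hypF A B C (1 - y) * ((y - x : ℝ) : ℂ) ^ (μ - 1)) (Ioi x) ∧
    ∫ y in Ioi x, hypF A B C (1 - y) * ((y - x : ℝ) : ℂ) ^ (μ - 1)
      = Gamma μ * KK A B C μ * hypF (A - μ) (B - μ) (C - μ) (1 - x) := by
  have hD : 0 < (C - B).re := by simp; linarith
  have hB0 : 0 < B.re := by linarith
  have hA0 : 0 < A.re := by linarith
  have hBμ : 0 < (B - μ).re := by simp; linarith
  have hAμ : 0 < (A - μ).re := by simp; linarith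
  have hCμ : 0 < (C - μ).re := by simp; linarith
  obtain ⟨h1, h2⟩ := weyl_base hμ hA hB hD hx
  rw [show B + (C - B) = C by ring] at h1 h2
  refine ⟨h1, ?_⟩
  rw [show B - μ + (C - B) = C - μ by ring, betaIntegral_eq_Gamma_mul_div _ _ hB0 hD,
    betaIntegral_eq_Gamma_mul_div _ _ hμ hAμ, betaIntegral_eq_Gamma_mul_div _ _ hBμ hD,
    show B + (C - B) = C by ring, show B - μ + (C - B) = C - μ by ring,
    show μ + (A - μ) = A by ring] at h2
  have g1 := Gamma_ne_zero_of_re_pos hD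
  have g2 := Gamma_ne_zero_of_re_pos hB0
  have g3 := Gamma_ne_zero_of_re_pos hA0
  have g4 := Gamma_ne_zero_of_re_pos hCμ
  have g5 := Gamma_ne_zero_of_re_pos (hB0.trans hC)
  rw [KK]
  apply mul_left_cancel₀ (div_ne_zero (mul_ne_zero g2 g1) g5)
  rw [h2]
  field_simp

lemma weyl_all (N : ℕ) : ∀ {A B C μ : ℂ} (_ : 0 < μ.re) (_ : μ.re < A.re) (_ : μ.re < B.re)
    (_ : B.re < C.re + N) (_ : ∀ n : ℕ, C ≠ -(n : ℂ)) (_ : ∀ n : ℕ, C - μ ≠ -(n : ℂ))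
    {x : ℝ} (_ : 0 < x),
    IntegrableOn (fun y : ℝ => hypF A B C (1 - y) * ((y - x : ℝ) : ℂ) ^ (μ - 1)) (Ioi x) ∧
    ∫ y in Ioi x, hypF A B C (1 - y) * ((y - x : ℝ) : ℂ) ^ (μ - 1)
      = Gamma μ * KK A B C μ * hypF (A - μ) (B - μ) (C - μ) (1 - x) := by
  induction N with
  | zero =>
    intro A B C μ hμ hA hB hC _ _ x hx
    exact weyl_base' hμ hA hB (by simpa using hC) hx
  | succ N ih =>
    intro A B C μ hμ hA hB hC h1 h2 x hx
    push_cast at hC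
    have h1' := nonpole_add h1
    have h1'' := nonpole_add h1'
    have h2' := nonpole_add h2
    have h2'' := nonpole_add h2'
    rw [show C + 1 + 1 = C + 2 by ring] at h1''
    obtain ⟨i1, v1⟩ := ih hμ hA hB (C := C + 1) (by simp; linarith) h1'
      (by rwa [show C + 1 - μ = C - μ + 1 by ring]) hx
    obtain ⟨i2, v2⟩ := ih hμ (A := A + 1) (B := B + 1) (C := C + 2) (by simp; linarith)
      (by simp; linarith) (by simp; linarith) h1''
      (by rwa [show C + 2 - μ = C - μ + 1 + 1 by ring]) hx
    obtain ⟨i3, v3⟩ := ih (μ := μ + 1) (A := A + 1) (B := B + 1) (C := C + 2)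
      (by simp; linarith) (by simp; linarith)
      (by simp; linarith) (by simp; linarith) h1''
      (by rwa [show C + 2 - (μ + 1) = C - μ + 1 by ring]) hx
    set m := A * B / (C * (C + 1)) with hm
    have hC0 : C ≠ 0 := by simpa using h1 0
    have hC1 : C + 1 ≠ 0 := by simpa using add_nat_ne h1 1
    have key : EqOn (fun y : ℝ => hypF A B C (1 - y) * ((y - x : ℝ) : ℂ) ^ (μ - 1))
      (fun y : ℝ => hypF A B (C+1) (1 - y) * ((y - x : ℝ) : ℂ) ^ (μ - 1) +
        (m * (1 - x)) * (hypF (A+1) (B+1) (C+2) (1 - y) * ((y - x : ℝ) : ℂ) ^ (μ - 1)) -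
        m * (hypF (A+1) (B+1) (C+2) (1 - y) * ((y - x : ℝ) : ℂ) ^ (μ + 1 - 1))) (Ioi x) := by
      intro y hy
      have hy' : x < y := hy
      have hne : ((y - x : ℝ) : ℂ) ≠ 0 := by
        have : y - x ≠ 0 := by linarith
        exact_mod_cast this
      simp only
      rw [hypF_contig h1 (show 1 - y < 1 by linarith), show μ + 1 - 1 = μ - 1 + 1 by ring,
        cpow_add _ _ hne, cpow_one, ← hm]
      push_cast
      ring
    have I2 := i2.const_mul (m * (1 - x))
    have I3 := i3.const_mul m
    have I12 : Integrable (fun y : ℝ => hypF A B (C+1) (1 - y) * ((y - x : ℝ) : ℂ) ^ (μ - 1) +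
        (m * (1 - x)) * (hypF (A+1) (B+1) (C+2) (1 - y) * ((y - x : ℝ) : ℂ) ^ (μ - 1)))
        (volume.restrict (Ioi x)) := i1.add I2
    refine ⟨IntegrableOn.congr_fun (I12.sub I3) key.symm measurableSet_Ioi, ?_⟩
    rw [setIntegral_congr_fun measurableSet_Ioi key]
    rw [integral_sub I12 I3, integral_add i1 I2, integral_const_mul, integral_const_mul, v1, v2, v3]
    have hμ0 : μ ≠ 0 := by intro h; simp [h] at hμ
    have hA0 : A ≠ 0 := by intro h; simp [h] at hA; linarith
    have hB0 : B ≠ 0 := by intro h; simp [h] at hB; linarith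
    have ha0 : A - μ ≠ 0 := by intro h; rw [sub_eq_zero.1 h] at hA; linarith
    have hb0 : B - μ ≠ 0 := by intro h; rw [sub_eq_zero.1 h] at hB; linarith
    have hc0 : C - μ ≠ 0 := by simpa using h2 0
    have hc1 : C - μ + 1 ≠ 0 := by simpa using add_nat_ne h2 1
    have gA : Gamma A ≠ 0 := Gamma_ne_zero_of_re_pos (by linarith)
    have gB : Gamma B ≠ 0 := Gamma_ne_zero_of_re_pos (by linarith)
    have gc : Gamma (C - μ) ≠ 0 := Gamma_ne_zero h2
    rw [hypF_contig h2 (show 1 - x < 1 by linarith)]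
    simp only [KK]
    rw [show A + 1 - (μ + 1) = A - μ by ring, show B + 1 - (μ + 1) = B - μ by ring,
      show C + 2 - (μ + 1) = C - μ + 1 by ring, show A + 1 - μ = A - μ + 1 by ring,
      show B + 1 - μ = B - μ + 1 by ring, show C + 1 - μ = C - μ + 1 by ring,
      show C + 2 - μ = C - μ + 2 by ring,
      show Gamma (C - μ + 2) = (C - μ + 1) * ((C - μ) * Gamma (C - μ)) by
        rw [← Gamma_add_one _ hc0, ← Gamma_add_one _ hc1]; congr 1; ring,
      show Gamma (C + 2) = (C + 1) * (C * Gamma C) by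
        rw [← Gamma_add_one _ hC0, ← Gamma_add_one _ hC1]; congr 1; ring,
      Gamma_add_one _ hC0, Gamma_add_one _ hA0, Gamma_add_one _ hB0, Gamma_add_one _ hμ0,
      Gamma_add_one _ ha0, Gamma_add_one _ hb0, Gamma_add_one _ hc0, hm]
    generalize hypF (A - μ) (B - μ) (C - μ + 1) (1 - x) = U
    generalize hypF (A - μ + 1) (B - μ + 1) (C - μ + 2) (1 - x) = V
    push_cast
    field_simp
    ring

/-- Fractional integral transformation of type `c-` for the solution `w₅`. -/
theorem stmt_16 (a b c μ : ℂ)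
    (ha : μ.re < (a - c + 1).re) (hb : μ.re < (b - c + 1).re) (hμ : 0 < μ.re)
    (h1 : ∀ n : ℕ, a + b - c + 1 ≠ -(n : ℂ)) (h2 : ∀ n : ℕ, a + b - c - μ + 1 ≠ -(n : ℂ))
    (x : ℝ) (hx : 0 < x) :
    ∫ y in Ioi x,
        (y : ℂ) ^ (c - 1) * w5 a b c y *
          (((y - x : ℝ) : ℂ) ^ (μ - 1) / Complex.Gamma μ)
      = Complex.Gamma (b - c - μ + 1) / Complex.Gamma (b - c + 1) *
        (Complex.Gamma (a - c - μ + 1) / Complex.Gamma (a - c + 1)) *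
        (Complex.Gamma (a + b - c + 1) / Complex.Gamma (a + b - c - μ + 1)) *
        (x : ℂ) ^ (c + μ - 1) * w5 a b (c + μ) x := by
  obtain ⟨N, hN⟩ := exists_nat_gt ((b - c + 1).re - (a + b - c + 1).re)
  have h2' : ∀ n : ℕ, a + b - c + 1 - μ ≠ -(n : ℂ) := by
    rwa [show a + b - c + 1 - μ = a + b - c - μ + 1 by ring]
  obtain ⟨-, hv⟩ := weyl_all N hμ ha hb (by linarith) h1 h2' hx
  have gμ : Gamma μ ≠ 0 := Gamma_ne_zero_of_re_pos hμ
  have e : ∫ y in Ioi x, (y : ℂ) ^ (c - 1) * w5 a b c y *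
          (((y - x : ℝ) : ℂ) ^ (μ - 1) / Complex.Gamma μ)
      = (Gamma μ)⁻¹ * ∫ y in Ioi x, hypF (a-c+1) (b-c+1) (a+b-c+1) (1 - y) *
          ((y - x : ℝ) : ℂ) ^ (μ - 1) := by
    rw [← integral_const_mul]
    refine setIntegral_congr_fun measurableSet_Ioi fun y hy => ?_
    rw [w5_euler h1 (hx.trans hy)]
    ring
  have e2 := w5_euler (a := a) (b := b) (c := c + μ)
    (by rwa [show a + b - (c + μ) + 1 = a + b - c - μ + 1 by ring]) hx
  rw [e, hv, mul_assoc _ ((x:ℂ) ^ _), e2, KK]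
  rw [show a - (c + μ) + 1 = a - c - μ + 1 by ring, show b - (c + μ) + 1 = b - c - μ + 1 by ring,
    show a + b - (c + μ) + 1 = a + b - c - μ + 1 by ring,
    show a - c + 1 - μ = a - c - μ + 1 by ring, show b - c + 1 - μ = b - c - μ + 1 by ring,
    show a + b - c + 1 - μ = a + b - c - μ + 1 by ring]
  field_simp
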